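/- (Theorem: the choice structure of the abstract decision framework satisfies the weak axiom of revealed preference.) For all nonempty finite sets B, B' of alternatives and all x, y : X, if x ∈ B, y ∈ B and x ∈ Λ(B), and x ∈ B', y ∈ B' and y ∈ Λ(B'), then x ∈ Λ(B'). -/

import Mathlib

/-- `better v x y` iff some criterion `i` favors `x` over `y` (`v i x < v i y`)
and all higher-priority criteria `j > i` are ties. -/
def better {X I : Type*} [LinearOrder I] (v : I → X → ℝ) (x y : X) : Prop :=
  ∃ i : I, v i x < v i y ∧ ∀ j : I, i < j → v j x = v j y

/-- The set of acceptable alternatives `Λ(B)` computed by Algorithm 1 from the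
decision rules DR1 and DR2. -/
def acceptable {X I : Type*} [LinearOrder I] (v : I → X → ℝ) (B : Finset X) :
    Set X :=
  if B.card = 1 then ↑B
  else
    {w | w ∈ B ∧
      ((∃ y ∈ B, better v w y) ∧ (∀ z ∈ B, ¬ better v z w) ∨
        ∃ y ∈ B, y ≠ w ∧ ¬ better v w y ∧ ¬ better v y w ∧
          ∀ z ∈ B, ¬ (better v z w ∨ better v z y))}

/-- Alternatives that are incomparable under `better` have the same attributes. -/
theorem attributes_eq_of_not_better {X I : Type*} [LinearOrder I] [Finite I]
    {v : I → X → ℝ} {x y : X} (hxy : ¬ better v x y) (hyx : ¬ better v y x) (i : I) :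
    v i x = v i y := by
  induction i using WellFoundedGT.induction with
  | ind i ih =>
    refine le_antisymm (not_lt.1 fun h => hyx ⟨i, h, fun j hj => (ih j hj).symm⟩)
      (not_lt.1 fun h => hxy ⟨i, h, ih⟩)

theorem better_congr_right {X I : Type*} [LinearOrder I] {v : I → X → ℝ} {x y : X}
    (h : ∀ i, v i x = v i y) (z : X) : better v z x ↔ better v z y := by
  simp only [better, h]

theorem not_better_self {X I : Type*} [LinearOrder I] (v : I → X → ℝ) (x : X) :
    ¬ better v x x :=
  fun ⟨_, h, _⟩ => lt_irrefl _ h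

/-- The acceptable alternatives are those to which no other alternative is better. -/
theorem mem_acceptable_iff {X I : Type*} [LinearOrder I] [Finite I] {v : I → X → ℝ}
    {B : Finset X} {w : X} :
    w ∈ acceptable v B ↔ w ∈ B ∧ ∀ z ∈ B, ¬ better v z w := by
  unfold acceptable
  split_ifs with hcard
  · obtain ⟨a, rfl⟩ := Finset.card_eq_one.1 hcard
    simp +contextual [not_better_self]
  · refine and_congr_right fun hw => ⟨?_, fun hmax => ?_⟩
    · rintro (⟨-, h⟩ | ⟨y, -, -, -, -, h⟩) z hz hzw
      · exact h z hz hzw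
      · exact h z hz (Or.inl hzw)
    · have hB : 1 < B.card := by
        have := Finset.card_pos.2 ⟨w, hw⟩
        omega
      obtain ⟨y, hy, hyw⟩ := Finset.exists_mem_ne hB w
      by_cases hwy : better v w y
      · exact Or.inl ⟨⟨y, hy, hwy⟩, hmax⟩
      · have heq := attributes_eq_of_not_better hwy (hmax y hy)
        refine Or.inr ⟨y, hy, hyw, hwy, hmax y hy, fun z hz h => ?_⟩
        rw [← better_congr_right heq z, or_self] at h
        exact hmax z hz h

/-- The choice structure of the abstract decision framework satisfies the weak
axiom of revealed preference. -/
theorem acceptable_satisfies_warp {X I : Type*} [LinearOrder I] [Fintype I]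
    (v : I → X → ℝ) (B B' : Finset X) (hB : B.Nonempty) (hB' : B'.Nonempty)
    (x y : X) (hxB : x ∈ B) (hyB : y ∈ B) (hx : x ∈ acceptable v B)
    (hxB' : x ∈ B') (hyB' : y ∈ B') (hy : y ∈ acceptable v B') :
    x ∈ acceptable v B' := by
  rw [mem_acceptable_iff] at hx hy ⊢
  have heq := attributes_eq_of_not_better (hy.2 x hxB') (hx.2 y hyB)
  exact ⟨hxB', fun z hz h => hy.2 z hz ((better_congr_right heq z).1 h)⟩
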